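/- arXiv:1705.00328 — 6 statements merged into one kernel-verified Lean document; each statement's English description precedes it below -/
import Mathlib

section
/- Let P be a real m×n matrix. Then P is row-permutation-like if and only if P(f.g) = (Pf).(Pg) for all vectors f, g ∈ ℝ^n. -/
/-- A real matrix is row-permutation-like if every entry is 0 or 1 and
each row contains at most one entry equal to 1. -/
def RowPermutationLike {m n : ℕ} (P : Matrix (Fin m) (Fin n) ℝ) : Prop :=
  (∀ i j, P i j = 0 ∨ P i j = 1) ∧
  (∀ i j k, P i j = 1 → P i k = 1 → j = k)

theorem RowPermutationLike.mul_entry {m n : ℕ} {P : Matrix (Fin m) (Fin n) ℝ}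
    (hP : RowPermutationLike P) (i : Fin m) (j k : Fin n) :
    P i j * P i k = if j = k then P i j else 0 := by
  split_ifs with h
  · subst h
    rcases hP.1 i j with h0 | h1 <;> simp [*]
  · rcases hP.1 i j with h0 | h1
    · simp [h0]
    · rcases hP.1 i k with h0' | h1'
      · simp [h0']
      · exact absurd (hP.2 i j k h1 h1') h

theorem stmt_0 {m n : ℕ} (P : Matrix (Fin m) (Fin n) ℝ) :
    RowPermutationLike P ↔
      ∀ f g : Fin n → ℝ, P.mulVec (f * g) = P.mulVec f * P.mulVec g := by
  constructor
  · intro hP f g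
    ext i
    simp only [Pi.mul_apply, Matrix.mulVec, dotProduct, Finset.sum_mul_sum]
    refine Finset.sum_congr rfl fun j _ => ?_
    simp only [mul_mul_mul_comm, hP.mul_entry, ite_mul, zero_mul, Finset.sum_ite_eq,
      Finset.mem_univ, if_true]
  · intro h
    have hmul (i : Fin m) (j k : Fin n) :
        P i j * P i k = P.mulVec (Pi.single j 1 * Pi.single k 1) i := by
      simp [h]
    refine ⟨fun i j => ?_, fun i j k hj hk => ?_⟩
    · have hj := hmul i j j
      rw [← Pi.single_mul, one_mul, Matrix.mulVec_single_one, Matrix.col_apply] at hj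
      rwa [← IsIdempotentElem, IsIdempotentElem.iff_eq_zero_or_one] at hj
    · by_contra hjk
      have hz : (Pi.single j 1 * Pi.single k 1 : Fin n → ℝ) = 0 := by
        ext l
        by_cases hl : l = j <;> simp_all [Pi.single_apply]
      simpa [hj, hk, hz] using hmul i j k
end

section
/- Let P be a real m×n matrix. Then P is row-permutation-like if and only if P·diag(f) = diag(Pf)·P for all vectors f ∈ ℝ^n. -/
theorem stmt_1 {m n : ℕ} (P : Matrix (Fin m) (Fin n) ℝ) :
    RowPermutationLike P ↔
      ∀ f : Fin n → ℝ, P * Matrix.diagonal f = Matrix.diagonal (P.mulVec f) * P := by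
  have entrywise : (∀ f : Fin n → ℝ,
      P * Matrix.diagonal f = Matrix.diagonal (P.mulVec f) * P) ↔
      ∀ (f : Fin n → ℝ) i j, P i j * f j = (∑ k, P i k * f k) * P i j := by
    refine forall_congr' fun f => ?_
    rw [← Matrix.ext_iff]
    simp only [Matrix.mul_diagonal, Matrix.diagonal_mul, Matrix.mulVec, dotProduct]
  rw [entrywise]
  constructor
  · rintro ⟨h01, huniq⟩ f i j
    rcases h01 i j with hj | hj
    · simp [hj]
    · rw [Finset.sum_eq_single j, hj, mul_one]
      · intro k _ hkj
        rcases h01 i k with hk | hk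
        · simp [hk]
        · exact absurd (huniq i k j hk hj) hkj
      · simp
  · intro h
    have key : ∀ i j k, P i j * (Pi.single k 1 : Fin n → ℝ) j = P i k * P i j := by
      intro i j k
      simpa [Pi.single_apply] using h (Pi.single k 1) i j
    refine ⟨fun i j => ?_, fun i j k hj hk => ?_⟩
    · have hjj := key i j j
      rw [Pi.single_eq_same, mul_one] at hjj
      by_cases h0 : P i j = 0
      · exact Or.inl h0
      · exact Or.inr (mul_right_cancel₀ h0 (by rw [one_mul, ← hjj]))
    · by_contra hne
      have hjk := key i j k
      rw [Pi.single_eq_of_ne hne, hj, hk] at hjk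
      norm_num at hjk
end

section
/- Let P be a real m×n matrix such that P(f.g) = (Pf).(Pg) for all vectors f, g ∈ ℝ^n. Then P is row-permutation-like, i.e., every entry of P is 0 or 1 and each row of P contains at most one entry equal to 1. -/
theorem stmt_3 {m n : ℕ} (P : Matrix (Fin m) (Fin n) ℝ)
    (h : ∀ f g : Fin n → ℝ, P.mulVec (f * g) = P.mulVec f * P.mulVec g) :
    (∀ i j, P i j = 0 ∨ P i j = 1) ∧
    (∀ i j k, P i j = 1 → P i k = 1 → j = k) := by
  constructor
  · intro i j
    have hij := congrFun (h (Pi.single j 1) (Pi.single j 1)) i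
    rw [← Pi.single_mul] at hij
    simp only [mul_one, Matrix.mulVec_single_one, Pi.mul_apply, Matrix.col_apply] at hij
    have hfactor : P i j * (P i j - 1) = 0 := by linarith
    exact (mul_eq_zero.mp hfactor).imp_right sub_eq_zero.mp
  · intro i j k hj hk
    by_contra hjk
    have hijk := congrFun (h (Pi.single j 1) (Pi.single k 1)) i
    have hzero : (Pi.single j 1 * Pi.single k 1 : Fin n → ℝ) = 0 := by
      ext l
      by_cases hl : l = j
      · subst hl
        simp [hjk]
      · simp [hl]
    rw [hzero] at hijk
    simp [hj, hk] at hijk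
end

section
/- Let P be a real m×n matrix. Then P is column-permutation-like if and only if P^T(f.g) = (P^T f).(P^T g) for all vectors f, g ∈ ℝ^m, where P^T is the transpose of P. -/
/-- A real matrix is column-permutation-like if every entry is 0 or 1 and
each column contains at most one entry equal to 1. -/
def ColPermutationLike {m n : ℕ} (P : Matrix (Fin m) (Fin n) ℝ) : Prop :=
  (∀ i j, P i j = 0 ∨ P i j = 1) ∧
  (∀ j i k, P i j = 1 → P k j = 1 → i = k)

theorem stmt_5 {m n : ℕ} (P : Matrix (Fin m) (Fin n) ℝ) :
    ColPermutationLike P ↔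
      ∀ f g : Fin m → ℝ, P.transpose.mulVec (f * g) =
        P.transpose.mulVec f * P.transpose.mulVec g := by
  constructor
  · rintro ⟨h01, hinj⟩ f g
    ext j
    simp only [Matrix.mulVec, dotProduct, Matrix.transpose_apply, Pi.mul_apply]
    by_cases h : ∃ i, P i j = 1
    · obtain ⟨i, hi⟩ := h
      have hz : ∀ k, k ≠ i → P k j = 0 := fun k hk =>
        (h01 k j).resolve_right fun hk1 => hk (hinj j k i hk1 hi)
      have hsum : ∀ v : Fin m → ℝ, ∑ k, P k j * v k = v i := fun v => by
        rw [Fintype.sum_eq_single i fun k hk => by rw [hz k hk, zero_mul], hi, one_mul]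
      rw [hsum f, hsum g]
      exact hsum (f * g)
    · have hz : ∀ k, P k j = 0 := fun k => (h01 k j).resolve_right fun hk => h ⟨k, hk⟩
      simp [hz]
  · intro h
    have key : ∀ i k j, P i j * (Pi.single k 1 : Fin m → ℝ) i = P i j * P k j := by
      intro i k j
      have := congrFun (h (Pi.single i 1) (Pi.single k 1)) j
      rw [← Pi.single_mul_left] at this
      simpa [Matrix.mulVec_single] using this
    refine ⟨fun i j => ?_, fun j i k hi hk => ?_⟩
    · have := key i i j
      rw [Pi.single_eq_same] at this
      rcases mul_eq_mul_left_iff.mp this with h1 | h0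
      · exact Or.inr h1.symm
      · exact Or.inl h0
    · by_contra hik
      have := key i k j
      rw [Pi.single_eq_of_ne hik, hi, hk] at this
      norm_num at this
end

section
/- Let P be a real m×n matrix. Then P is column-permutation-like if and only if diag(f)·P = P·diag(P^T f) for all vectors f ∈ ℝ^m, where P^T is the transpose of P. -/
/-- Testing `diag(f) P = P diag(Pᵀ f)` on the standard basis vectors `f` shows that it amounts to
orthogonality relations between the entries of each column. -/
theorem diagonal_mul_eq_mul_diagonal_iff {m n : ℕ} (P : Matrix (Fin m) (Fin n) ℝ) :
    (∀ f : Fin m → ℝ,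
        Matrix.diagonal f * P = P * Matrix.diagonal (P.transpose.mulVec f)) ↔
      ∀ i k j, P i j * P k j = if i = k then P i j else 0 := by
  constructor
  · intro h i k j
    have hij := congrFun (congrFun (h (Pi.single k 1)) i) j
    simpa [Matrix.diagonal_mul, Matrix.mul_diagonal, Pi.single_apply] using hij.symm
  · intro h f
    ext i j
    simp [Matrix.diagonal_mul, Matrix.mul_diagonal, Matrix.mulVec, dotProduct,
      Finset.mul_sum, ← mul_assoc, h, mul_comm (f i)]

theorem stmt_6 {m n : ℕ} (P : Matrix (Fin m) (Fin n) ℝ) :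
    ColPermutationLike P ↔
      ∀ f : Fin m → ℝ,
        Matrix.diagonal f * P = P * Matrix.diagonal (P.transpose.mulVec f) := by
  rw [diagonal_mul_eq_mul_diagonal_iff]
  constructor
  · rintro ⟨h01, huniq⟩ i k j
    split_ifs with hik
    · subst hik
      rcases h01 i j with h | h <;> simp [h]
    · rcases h01 i j with hi | hi
      · simp [hi]
      · rcases h01 k j with hk | hk
        · simp [hk]
        · exact absurd (huniq j i k hi hk) hik
  · intro h
    refine ⟨fun i j => ?_, fun j i k hi hk => ?_⟩
    · have hii := h i i j
      rw [if_pos rfl] at hii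
      exact IsIdempotentElem.iff_eq_zero_or_one.mp hii
    · by_contra hik
      have hzero := h i k j
      simp [hi, hk, hik] at hzero
end

section
/- Let m ≤ n and let P be a real m×n matrix. Then there exists an injective map π : {1,…,m} → {1,…,n} such that P is the discrete composition matrix generated by π if and only if the following three conditions hold: (1) P(f.g) = (Pf).(Pg) for all f, g ∈ ℝ^n and P^T(f.g) = (P^T f).(P^T g) for all f, g ∈ ℝ^m; (2) P·diag(f) = diag(Pf)·P for all f ∈ ℝ^n and diag(f)·P = P·diag(P^T f) for all f ∈ ℝ^m; (3) every row sum of P equals 1. -/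
/-- If multiplication by `P` is compatible with the Hadamard product, then distinct entries in a row
have product zero and every entry is idempotent. -/
lemma Matrix.mul_apply_eq_ite_of_mulVec_mul {k l : Type*} [Fintype l] [DecidableEq l]
    {P : Matrix k l ℝ}
    (h : ∀ f g : l → ℝ, P.mulVec (f * g) = P.mulVec f * P.mulVec g) (i : k) (a b : l) :
    P i a * P i b = if a = b then P i a else 0 := by
  have key := congrFun (h (Pi.single a 1) (Pi.single b 1)) i
  rw [Pi.mul_apply, Matrix.mulVec_single_one, Matrix.mulVec_single_one] at key
  simp only [Matrix.col_apply] at key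
  rw [← key]
  split_ifs with hab
  · subst hab
    rw [← Pi.single_mul, mul_one, Matrix.mulVec_single_one, Matrix.col_apply]
  · have hz : (Pi.single a 1 * Pi.single b 1 : l → ℝ) = 0 := by
      ext c
      by_cases hc : c = a
      · subst hc
        simp [hab]
      · simp [hc]
    rw [hz, Matrix.mulVec_zero, Pi.zero_apply]


theorem stmt_14 {m n : ℕ} (hmn : m ≤ n) (P : Matrix (Fin m) (Fin n) ℝ) :
    (∃ π : Fin m → Fin n, Function.Injective π ∧
        ∀ i j, P i j = if π i = j then 1 else 0) ↔
      ((∀ f g : Fin n → ℝ, P.mulVec (f * g) = P.mulVec f * P.mulVec g) ∧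
        (∀ f g : Fin m → ℝ, P.transpose.mulVec (f * g) =
          P.transpose.mulVec f * P.transpose.mulVec g)) ∧
      ((∀ f : Fin n → ℝ, P * Matrix.diagonal f = Matrix.diagonal (P.mulVec f) * P) ∧
        (∀ f : Fin m → ℝ,
          Matrix.diagonal f * P = P * Matrix.diagonal (P.transpose.mulVec f))) ∧
      (∀ i, ∑ j, P i j = 1) := by
  constructor
  · rintro ⟨π, hπ, hP⟩
    have hmul (f : Fin n → ℝ) (i) : P.mulVec f i = f (π i) := by
      simp [Matrix.mulVec, dotProduct, hP]
    have htr (f : Fin m → ℝ) (i) : P.transpose.mulVec f (π i) = f i := by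
      simp [Matrix.mulVec, dotProduct, hP, hπ.eq_iff]
    have htr_zero (f : Fin m → ℝ) (j) (hj : ∀ i, π i ≠ j) : P.transpose.mulVec f j = 0 := by
      simp [Matrix.mulVec, dotProduct, hP, hj]
    refine ⟨⟨fun f g => ?_, fun f g => ?_⟩, ⟨fun f => ?_, fun f => ?_⟩, fun i => ?_⟩
    · ext i
      simp [hmul]
    · ext j
      by_cases hj : ∃ i, π i = j
      · obtain ⟨i, rfl⟩ := hj
        simp [htr]
      · push Not at hj
        simp [htr_zero _ j hj]
    · ext i j
      rw [Matrix.mul_diagonal, Matrix.diagonal_mul, hmul, hP]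
      split_ifs with h
      · rw [h, mul_comm]
      · simp
    · ext i j
      rw [Matrix.mul_diagonal, Matrix.diagonal_mul, hP]
      split_ifs with h
      · rw [← h, htr, mul_comm]
      · simp
    · simp [hP]
  · rintro ⟨⟨hrow, hcol⟩, -, hsum⟩
    have hrow_mul := Matrix.mul_apply_eq_ite_of_mulVec_mul hrow
    have hcol_mul := Matrix.mul_apply_eq_ite_of_mulVec_mul hcol
    have hex (i) : ∃ j, P i j = 1 := by
      obtain ⟨j, -, hj⟩ := Finset.exists_ne_zero_of_sum_ne_zero
        (s := Finset.univ) (f := P i) (by rw [hsum i]; exact one_ne_zero)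
      exact ⟨j, mul_left_cancel₀ hj (by simpa using hrow_mul i j j)⟩
    choose π hπ using hex
    refine ⟨π, fun a b hab => ?_, fun i j => ?_⟩
    · by_contra hne
      have h := hcol_mul (π a) a b
      rw [if_neg hne, Matrix.transpose_apply, Matrix.transpose_apply, hπ, hab, hπ] at h
      norm_num at h
    · have h := hrow_mul i (π i) j
      rwa [hπ, one_mul] at h
end
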